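/- Let T be a triangulated category. Suppose given objects N, M, Z, Z' and morphisms s : N → M, t : N → Z, t' : N → Z', u : M → Z, u' : M → Z', v : Z → Z, v' : Z' → Z' such that the two squares (s, t, u, v) and (s, t', u', v') are homotopy cartesian, i.e. the triangles N → Z ⊕ M → Z → N⟦1⟧ (first map components t, s; second map components v, −u) and N → Z' ⊕ M → Z' → N⟦1⟧ (first map components t', s; second map components v', −u') are distinguished. Let X be a homotopy pushout of t and t', i.e. there are y : Z → X, y' : Z' → X with a distinguished triangle N → Z ⊕ Z' → X → N⟦1⟧ (first map components t, t'; second map components y, −y'), and let Y be a homotopy pushout of u and u', with w : Z → Y, w' : Z' → Y and distinguished triangle M → Z ⊕ Z' → Y → M⟦1⟧ (first map components u, u'; second map components w, −w'). Then there exists a morphism d : X → Y such that the triangle Z' → Z' ⊕ X → Y → Z'⟦1⟧, with first map of components v' and y' and second map of components w' and d, is distinguished. In particular X ≤_Δ Y, and X ≤_{Δ+nil} Y when v' is nilpotent. -/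

import Mathlib

open CategoryTheory Category Limits Pretriangulated

/-- An endomorphism `v` of `Z` is nilpotent if some positive power of it
(in the endomorphism ring `End Z`) vanishes. -/
def IsNilpotentEndo {T : Type*} [Category T] [Preadditive T] {Z : T} (v : Z ⟶ Z) : Prop :=
  ∃ n : ℕ, 0 < n ∧ (show End Z from v) ^ n = 0

/-- `A ≤_Δ B` : there are an object `W` and a distinguished triangle
`W → W ⊕ A → B → W⟦1⟧` whose first morphism has components an endomorphism of `W`
and a map `W ⟶ A`. -/
def Deg (T : Type*) [Category T] [Preadditive T] [HasZeroObject T] [HasShift T ℤ]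
    [∀ n : ℤ, (shiftFunctor T n).Additive] [Pretriangulated T] [HasBinaryBiproducts T]
    (A B : T) : Prop :=
  ∃ (W : T) (v : W ⟶ W) (u : W ⟶ A) (g : W ⊞ A ⟶ B) (h : B ⟶ W⟦(1 : ℤ)⟧),
    Triangle.mk (biprod.lift v u) g h ∈ distTriang T

/-- `A ≤_{Δ+nil} B` : as in `Deg`, with the `W`-endomorphism component nilpotent. -/
def DegNil (T : Type*) [Category T] [Preadditive T] [HasZeroObject T] [HasShift T ℤ]
    [∀ n : ℤ, (shiftFunctor T n).Additive] [Pretriangulated T] [HasBinaryBiproducts T]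
    (A B : T) : Prop :=
  ∃ (W : T) (v : W ⟶ W) (u : W ⟶ A) (g : W ⊞ A ⟶ B) (h : B ⟶ W⟦(1 : ℤ)⟧),
    IsNilpotentEndo v ∧ Triangle.mk (biprod.lift v u) g h ∈ distTriang T


section

variable {T : Type*} [Category T] [Preadditive T] [HasZeroObject T] [HasShift T ℤ]
  [∀ n : ℤ, (shiftFunctor T n).Additive] [Pretriangulated T]

open ZeroObject

lemma distinguished_mk_of_iso {X Y Z X' Y' Z' : T} {f : X ⟶ Y} {g : Y ⟶ Z}
    {h : Z ⟶ X⟦(1 : ℤ)⟧} {f' : X' ⟶ Y'} {g' : Y' ⟶ Z'} {h' : Z' ⟶ X'⟦(1 : ℤ)⟧}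
    (hT : Triangle.mk f g h ∈ distTriang T) (a : X ≅ X') (b : Y ≅ Y') (c : Z ≅ Z')
    (hf : f ≫ b.hom = a.hom ≫ f') (hg : g ≫ c.hom = b.hom ≫ g')
    (hh : h ≫ a.hom⟦(1 : ℤ)⟧' = c.hom ≫ h') :
    Triangle.mk f' g' h' ∈ distTriang T :=
  isomorphic_distinguished _ hT _ (Triangle.isoMk _ _ a b c hf hg hh).symm

variable [HasBinaryBiproducts T]

/-- The direct sum of a distinguished triangle and the triangle `0 ⟶ B ⟶ B ⟶ 0`. -/
lemma distinguished_biprod_contractible {X Y Z : T} {f : X ⟶ Y} {g : Y ⟶ Z}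
    {h : Z ⟶ X⟦(1 : ℤ)⟧} (hT : Triangle.mk f g h ∈ distTriang T) (B : T) :
    Triangle.mk (f ≫ biprod.inl : X ⟶ Y ⊞ B) (biprod.map g (𝟙 B)) (biprod.fst ≫ h)
      ∈ distTriang T := by
  let F : Bool → Triangle T := fun b =>
    bif b then Triangle.mk f g h else Triangle.mk (0 : (0 : T) ⟶ B) (𝟙 B) 0
  have hF : ∀ b, F b ∈ distTriang T := by
    rintro (_ | _)
    · exact contractible_distinguished₁ B
    · exact hT
  let S := Triangle.mk (f ≫ biprod.inl : X ⟶ Y ⊞ B) (biprod.map g (𝟙 B)) (biprod.fst ≫ h)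
  let π₁ : S ⟶ Triangle.mk f g h :=
    Triangle.homMk _ _ (𝟙 X) biprod.fst biprod.fst
      (show (f ≫ biprod.inl) ≫ biprod.fst = 𝟙 X ≫ f by simp)
      (show biprod.map g (𝟙 B) ≫ biprod.fst = biprod.fst ≫ g by simp)
      (show (biprod.fst ≫ h) ≫ (𝟙 X)⟦(1 : ℤ)⟧' = biprod.fst ≫ h by simp)
  let π₂ : S ⟶ Triangle.mk (0 : (0 : T) ⟶ B) (𝟙 B) 0 :=
    Triangle.homMk _ _ 0 biprod.snd biprod.snd
      (show (f ≫ biprod.inl) ≫ biprod.snd = (0 : X ⟶ 0) ≫ (0 : 0 ⟶ B) by simp)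
      (show biprod.map g (𝟙 B) ≫ biprod.snd = biprod.snd ≫ 𝟙 B by simp)
      (show (biprod.fst ≫ h) ≫ (0 : X ⟶ 0)⟦(1 : ℤ)⟧' = biprod.snd ≫ 0 by simp)
  let c : Fan F := Fan.mk S (fun b => match b with
    | true => π₁
    | false => π₂)
  have hc : IsLimit c := by
    refine Fan.IsLimit.mk _ (fun s => ?_) ?_ ?_
    · let a : s.pt ⟶ Triangle.mk f g h := s.proj true
      let b : s.pt ⟶ Triangle.mk (0 : (0 : T) ⟶ B) (𝟙 B) 0 := s.proj false
      let a₁ : s.pt.obj₁ ⟶ X := a.hom₁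
      let a₂ : s.pt.obj₂ ⟶ Y := a.hom₂
      let a₃ : s.pt.obj₃ ⟶ Z := a.hom₃
      let b₁ : s.pt.obj₁ ⟶ 0 := b.hom₁
      let b₂ : s.pt.obj₂ ⟶ B := b.hom₂
      let b₃ : s.pt.obj₃ ⟶ B := b.hom₃
      have ha₁ : s.pt.mor₁ ≫ a₂ = a₁ ≫ f := a.comm₁
      have ha₂ : s.pt.mor₂ ≫ a₃ = a₂ ≫ g := a.comm₂
      have ha₃ : s.pt.mor₃ ≫ a₁⟦(1 : ℤ)⟧' = a₃ ≫ h := a.comm₃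
      have hb₁ : s.pt.mor₁ ≫ b₂ = b₁ ≫ 0 := b.comm₁
      have hb₂ : s.pt.mor₂ ≫ b₃ = b₂ ≫ 𝟙 B := b.comm₂
      refine Triangle.homMk _ _ a₁ (biprod.lift a₂ b₂) (biprod.lift a₃ b₃)
        (show s.pt.mor₁ ≫ biprod.lift a₂ b₂ = a₁ ≫ f ≫ biprod.inl from ?_)
        (show s.pt.mor₂ ≫ biprod.lift a₃ b₃ = biprod.lift a₂ b₂ ≫ biprod.map g (𝟙 B) from ?_)
        (show s.pt.mor₃ ≫ a₁⟦(1 : ℤ)⟧' = biprod.lift a₃ b₃ ≫ biprod.fst ≫ h from ?_)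
      · ext <;> simp [ha₁, hb₁]
      · ext <;> simp [ha₂, hb₂]
      · simp [ha₃]
    · rintro s (_ | _)
      · ext
        · exact (isZero_zero T).eq_of_tgt _ _
        · exact biprod.lift_snd _ _
        · exact biprod.lift_snd _ _
      · ext
        · exact comp_id _
        · exact biprod.lift_fst _ _
        · exact biprod.lift_fst _ _
    · intro s m hm
      have ht : m ≫ π₁ = s.proj true := hm true
      have hf : m ≫ π₂ = s.proj false := hm false
      ext
      · exact (comp_id _).symm.trans (congrArg TriangleMorphism.hom₁ ht)
      · apply biprod.hom_ext
        · exact (congrArg TriangleMorphism.hom₂ ht).trans (biprod.lift_fst _ _).symm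
        · exact (congrArg TriangleMorphism.hom₂ hf).trans (biprod.lift_snd _ _).symm
      · apply biprod.hom_ext
        · exact (congrArg TriangleMorphism.hom₃ ht).trans (biprod.lift_fst _ _).symm
        · exact (congrArg TriangleMorphism.hom₃ hf).trans (biprod.lift_snd _ _).symm
  exact isomorphic_distinguished _ (productTriangle_distinguished F hF) _
    (hc.conePointUniqueUpToIso (productTriangle.isLimitFan F))

variable [IsTriangulated T]

/-- If a homotopy cartesian square on `t, s` and one on `t, s ≫ f` are given, then there is a
morphism between the two homotopy pushouts such that the remaining square is homotopy
cartesian. -/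
lemma exists_homotopyCartesian_of_comp {N A B B' P Q : T} {t : N ⟶ A} {s : N ⟶ B} {f : B ⟶ B'}
    {p : A ⟶ P} {q : B ⟶ P} {δ : P ⟶ N⟦(1 : ℤ)⟧}
    (hP : Triangle.mk (biprod.lift t s) (biprod.desc p (-q)) δ ∈ distTriang T)
    {p' : A ⟶ Q} {q' : B' ⟶ Q} {δ' : Q ⟶ N⟦(1 : ℤ)⟧}
    (hQ : Triangle.mk (biprod.lift t (s ≫ f)) (biprod.desc p' (-q')) δ' ∈ distTriang T) :
    ∃ (d : P ⟶ Q) (θ : Q ⟶ B⟦(1 : ℤ)⟧), p ≫ d = p' ∧ q ≫ d = f ≫ q' ∧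
      Triangle.mk (biprod.lift q f) (biprod.desc d (-q')) θ ∈ distTriang T := by
  let e : (A ⊞ B) ⊞ B' ≅ B ⊞ (A ⊞ B') :=
    { hom := biprod.lift (biprod.fst ≫ biprod.snd) (biprod.lift (biprod.fst ≫ biprod.fst)
        (biprod.fst ≫ biprod.snd ≫ f + biprod.snd))
      inv := biprod.lift (biprod.lift (biprod.snd ≫ biprod.fst) biprod.fst)
        (biprod.snd ≫ biprod.snd - biprod.fst ≫ f)
      hom_inv_id := by ext <;> simp
      inv_hom_id := by ext <;> simp }
  let u₁₂ : N ⟶ B ⊞ (A ⊞ B') := biprod.lift s (biprod.lift t (s ≫ f))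
  let v₁₂ : B ⊞ (A ⊞ B') ⟶ P ⊞ B' := e.inv ≫ biprod.map (biprod.desc p (-q)) (𝟙 B')
  have h₁₂ : Triangle.mk u₁₂ v₁₂ (biprod.fst ≫ δ) ∈ distTriang T :=
    distinguished_mk_of_iso (distinguished_biprod_contractible hP B') (Iso.refl _) e (Iso.refl _)
      (by dsimp [u₁₂, e]; ext <;> simp) (by simp [v₁₂]) (by simp)
  have h₂₃ : Triangle.mk (biprod.snd : B ⊞ (A ⊞ B') ⟶ _) 0 (-biprod.inl⟦(1 : ℤ)⟧')
      ∈ distTriang T :=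
    rot_of_distTriang _ (binaryBiproductTriangle_distinguished B (A ⊞ B'))
  obtain ⟨o⟩ := IsTriangulated.octahedron_axiom (u₁₃ := biprod.lift t (s ≫ f))
    (by simp [u₁₂]) h₁₂ h₂₃ hQ
  have hv : biprod.inl ≫ v₁₂ = -biprod.lift q f := by
    dsimp [v₁₂, e]
    ext <;> simp
  have hv₂ : biprod.inl ≫ biprod.inr ≫ v₁₂ = p ≫ biprod.inl := by
    dsimp [v₁₂, e]
    ext <;> simp
  have hv₃ : biprod.inr ≫ biprod.inr ≫ v₁₂ = biprod.inr := by
    dsimp [v₁₂, e]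
    ext <;> simp
  have hm : o.m₁ = biprod.desc (biprod.inl ≫ o.m₁) (-q') := by
    ext
    · simp
    · have := (biprod.inr ≫ biprod.inr) ≫= o.comm₁
      simpa [reassoc_of% hv₃] using this
  have hp : p ≫ biprod.inl ≫ o.m₁ = p' := by
    have := (biprod.inl ≫ biprod.inr) ≫= o.comm₁
    simpa [reassoc_of% hv₂] using this
  have hmem : Triangle.mk (biprod.lift q f) o.m₁ (-o.m₃) ∈ distTriang T := by
    have hrot : Triangle.mk o.m₁ (-o.m₃) (-(biprod.lift q f)⟦(1 : ℤ)⟧') ∈ distTriang T := by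
      refine distinguished_mk_of_iso o.mem (Iso.refl _) (Iso.refl _) (-Iso.refl _) ?_ ?_ ?_
      · simp
      · simp
      · rw [Preadditive.neg_comp, ← Functor.map_comp, hv]
        simp
    exact (rotate_distinguished_triangle _).2 hrot
  refine ⟨biprod.inl ≫ o.m₁, -o.m₃, hp, ?_, hm ▸ hmem⟩
  have h0 : biprod.lift q f ≫ o.m₁ = 0 := comp_distTriang_mor_zero₁₂ _ hmem
  rw [hm] at h0
  rw [← sub_eq_zero]
  simpa [sub_eq_add_neg] using h0

end

/-- given two homotopy cartesian squares `(s,t,u,v)` and `(s,t',u',v')`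
on the same morphism `s : N ⟶ M`, a homotopy pushout `X` of `t, t'` and a homotopy
pushout `Y` of `u, u'`, there is a morphism `d : X ⟶ Y` making the triangle
`Z' → Z' ⊕ X → Y → Z'⟦1⟧` (first map of components `v', y'`; second map of
components `w', d`) distinguished. In particular `X ≤_Δ Y`, and `X ≤_{Δ+nil} Y`
when `v'` is nilpotent. -/
theorem stmt5 {T : Type*} [Category T] [Preadditive T] [HasZeroObject T] [HasShift T ℤ]
    [∀ n : ℤ, (shiftFunctor T n).Additive] [Pretriangulated T] [IsTriangulated T]
    [HasBinaryBiproducts T]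
    (N M Z Z' : T) (s : N ⟶ M) (t : N ⟶ Z) (t' : N ⟶ Z') (u : M ⟶ Z) (u' : M ⟶ Z')
    (v : Z ⟶ Z) (v' : Z' ⟶ Z')
    (δ₁ : Z ⟶ N⟦(1 : ℤ)⟧)
    (hsq₁ : Triangle.mk (biprod.lift t s) (biprod.desc v (-u)) δ₁ ∈ distTriang T)
    (δ₂ : Z' ⟶ N⟦(1 : ℤ)⟧)
    (hsq₂ : Triangle.mk (biprod.lift t' s) (biprod.desc v' (-u')) δ₂ ∈ distTriang T)
    (X : T) (y : Z ⟶ X) (y' : Z' ⟶ X) (δX : X ⟶ N⟦(1 : ℤ)⟧)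
    (hX : Triangle.mk (biprod.lift t t') (biprod.desc y (-y')) δX ∈ distTriang T)
    (Y : T) (w : Z ⟶ Y) (w' : Z' ⟶ Y) (δY : Y ⟶ M⟦(1 : ℤ)⟧)
    (hY : Triangle.mk (biprod.lift u u') (biprod.desc w (-w')) δY ∈ distTriang T) :
    ∃ (d : X ⟶ Y) (θ : Y ⟶ Z'⟦(1 : ℤ)⟧),
      (Triangle.mk (biprod.lift v' y') (biprod.desc w' d) θ ∈ distTriang T) ∧
      Deg T X Y ∧ (IsNilpotentEndo v' → DegNil T X Y) := by
  have hcomm : s ≫ u' = t' ≫ v' := by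
    have : biprod.lift t' s ≫ biprod.desc v' (-u') = 0 := comp_distTriang_mor_zero₁₂ _ hsq₂
    rw [biprod.lift_desc, Preadditive.comp_neg, ← sub_eq_add_neg, sub_eq_zero] at this
    exact this.symm
  obtain ⟨C, g, k, hC⟩ := distinguished_cocone_triangle (biprod.lift t (s ≫ u'))
  obtain ⟨p, q, rfl⟩ : ∃ p q, g = biprod.desc p (-q) :=
    ⟨biprod.inl ≫ g, -(biprod.inr ≫ g), by ext <;> simp⟩
  obtain ⟨c, θ, hc, -, hmem⟩ := exists_homotopyCartesian_of_comp hsq₁ hC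
  obtain ⟨E, -, hE⟩ := exists_iso_of_arrow_iso _ _ hmem hY (Iso.refl _)
  have hEcomm := E.hom.comm₂
  rw [hE] at hEcomm
  let φ : C ≅ Y := Triangle.π₃.mapIso E
  have hφ : biprod.desc c (-q) ≫ φ.hom = biprod.desc w (-w') :=
    hEcomm.trans (id_comp _)
  have hcφ : c ≫ φ.hom = w := by simpa using biprod.inl ≫= hφ
  have hqφ : q ≫ φ.hom = w' := by simpa using biprod.inr ≫= hφ
  have hcomp : Triangle.mk (biprod.lift t (t' ≫ v')) (biprod.desc (v ≫ w) (-w')) (φ.inv ≫ k)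
      ∈ distTriang T := by
    refine distinguished_mk_of_iso hC (Iso.refl _) (Iso.refl _) φ ?_ ?_ ?_
    · simp [hcomm]
    · ext <;> simp [← hc, hcφ, hqφ]
    · simp
  obtain ⟨d, θ', -, -, hd⟩ := exists_homotopyCartesian_of_comp hX hcomp
  have main : Triangle.mk (biprod.lift v' y') (biprod.desc w' (-d)) (-θ') ∈ distTriang T := by
    refine distinguished_mk_of_iso hd (Iso.refl _) (biprod.braiding _ _) (-Iso.refl _) ?_ ?_ ?_
    · ext <;> simp
    · ext <;> simp
    · simp
  exact ⟨-d, -θ', main, ⟨Z', v', y', _, _, main⟩, fun hv => ⟨Z', v', y', _, _, hv, main⟩⟩
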